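/- Let M be a matching of size ℓ−1 and M' a matching of size k+1 on a finite simple graph G, where 1 ≤ ℓ ≤ k. Then the symmetric-difference graph D(M,M') has at least k − ℓ + 2 ≥ 2 connected components that are paths containing exactly one more edge of M' than of M; consequently, the set N(M,M') of pairs obtained by swapping the colors along one such component has cardinality p ≥ 2, and every pair in N(M,M') consists of a matching of size ℓ and a matching of size k. -/

import Mathlib

/-- A matching on a simple graph `G`: a set of edges of `G` that are pairwise
disjoint (no two distinct edges share a vertex). -/
def IsMatchingSet {V : Type*} (G : SimpleGraph V) (M : Set (Sym2 V)) : Prop :=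
  M ⊆ G.edgeSet ∧ ∀ e ∈ M, ∀ f ∈ M, e ≠ f → ∀ v, v ∈ e → v ∉ f

/-- The symmetric-difference graph `D(M,M')`: the graph on the vertex set of `G` whose
edges are the edges in the symmetric difference `M Δ M'`. -/
def symmDiffGraph {V : Type*} (M M' : Set (Sym2 V)) : SimpleGraph V :=
  SimpleGraph.fromEdgeSet (symmDiff M M')

/-- The edge set of the connected component `c` of `D(M,M')`. -/
def compEdges {V : Type*} (M M' : Set (Sym2 V))
    (c : (symmDiffGraph M M').ConnectedComponent) : Set (Sym2 V) :=
  {e | e ∈ symmDiff M M' ∧ ∀ v ∈ e, v ∈ c.supp}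

/-- The connected component `c` of `D(M,M')` is a path. -/
def IsPathComponent {V : Type*} (M M' : Set (Sym2 V))
    (c : (symmDiffGraph M M').ConnectedComponent) : Prop :=
  ∃ n : ℕ, Nonempty ((symmDiffGraph M M').induce c.supp ≃g SimpleGraph.pathGraph n)

/-- A pink chain: a path component of `D(M,M')` containing exactly one more edge of `M'`
than of `M`. -/
def IsPinkChain {V : Type*} (M M' : Set (Sym2 V))
    (c : (symmDiffGraph M M').ConnectedComponent) : Prop :=
  IsPathComponent M M' c ∧
    (compEdges M M' c ∩ M').ncard = (compEdges M M' c ∩ M).ncard + 1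

/-- A blue chain: a path component of `D(M,M')` containing exactly one more edge of `M`
than of `M'`. -/
def IsBlueChain {V : Type*} (M M' : Set (Sym2 V))
    (c : (symmDiffGraph M M').ConnectedComponent) : Prop :=
  IsPathComponent M M' c ∧
    (compEdges M M' c ∩ M).ncard = (compEdges M M' c ∩ M').ncard + 1

/-- `p`, the number of pink chains of `D(M,M')`. -/
noncomputable def pinkCount {V : Type*} (M M' : Set (Sym2 V)) : ℕ :=
  Nat.card {c : (symmDiffGraph M M').ConnectedComponent // IsPinkChain M M' c}

/-- `b`, the number of blue chains of `D(M,M')`. -/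
noncomputable def blueCount {V : Type*} (M M' : Set (Sym2 V)) : ℕ :=
  Nat.card {c : (symmDiffGraph M M').ConnectedComponent // IsBlueChain M M' c}

/-- `N(M,M')`: the set of pairs obtained from `(M, M')` by swapping the colors along a
single pink chain (a path component of `D(M,M')` with exactly one more edge of `M'` than
of `M`). -/
def swapSet {V : Type*} (M M' : Set (Sym2 V)) : Set (Set (Sym2 V) × Set (Sym2 V)) :=
  {p | ∃ c : (symmDiffGraph M M').ConnectedComponent, IsPinkChain M M' c ∧
    p = ((M \ compEdges M M' c) ∪ (M' ∩ compEdges M M' c),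
         (M' \ compEdges M M' c) ∪ (M ∩ compEdges M M' c))}

/-- A path in a connected graph of maximum degree at most two which misses a vertex can be
extended at one of its ends. -/
lemma exists_isChain_nodup_length_succ {W : Type*} {H : SimpleGraph W} (hc : H.Connected)
    (hdeg : ∀ x a b c, H.Adj x a → H.Adj x b → H.Adj x c → a = b ∨ a = c ∨ b = c)
    {l : List W} (hl : l.IsChain H.Adj) (hnd : l.Nodup) (hmiss : ∃ w, w ∉ l) :
    ∃ l' : List W, l'.IsChain H.Adj ∧ l'.Nodup ∧ l'.length = l.length + 1 := by
  obtain ⟨w, hw⟩ := hmiss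
  rcases l with _ | ⟨u, t⟩
  · exact ⟨[w], by simp, by simp, by simp⟩
  obtain ⟨d, -, hd, hd'⟩ :=
    (hc.preconnected u w).some.exists_boundary_dart {x | x ∈ u :: t} (by simp) hw
  obtain ⟨⟨x, y⟩, hxy⟩ := d
  simp only [Set.mem_ofPred_eq] at hd hd'
  change H.Adj x y at hxy
  generalize u :: t = l at *
  obtain ⟨l₁, l₂, rfl⟩ := List.append_of_mem hd
  rcases List.eq_nil_or_concat l₁ with rfl | ⟨l₁, a, rfl⟩
  · exact ⟨y :: x :: l₂, by simpa [hxy.symm] using hl, by simp_all, by simp⟩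
  rcases l₂ with _ | ⟨b, l₂⟩
  · refine ⟨(l₁ ++ [a] ++ [x]) ++ [y], ?_, ?_, by simp⟩
    · rw [List.isChain_append]
      simp_all
    · rw [List.nodup_append]
      simp only [List.concat_eq_append] at hnd hd'
      exact ⟨hnd, by simp, by grind⟩
  · exfalso
    simp only [List.concat_eq_append, List.append_assoc, List.singleton_append] at hl hnd hd'
    have hax : H.Adj a x ∧ H.Adj x b := by
      rw [List.isChain_append_cons_cons, List.isChain_cons_cons] at hl
      exact ⟨hl.2.1, hl.2.2.1⟩
    have := hdeg x a b y hax.1.symm hax.2 hxy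
    grind

/-- A finite tree of maximum degree at most two is a path. -/
lemma SimpleGraph.IsTree.exists_iso_pathGraph {W : Type*} [Finite W] {H : SimpleGraph W}
    (ht : H.IsTree)
    (hdeg : ∀ x a b c, H.Adj x a → H.Adj x b → H.Adj x c → a = b ∨ a = c ∨ b = c) :
    ∃ n, Nonempty (H ≃g SimpleGraph.pathGraph n) := by
  classical
  have := Fintype.ofFinite W
  have hspan : ∃ l : List W, l.IsChain H.Adj ∧ l.Nodup ∧ ∀ x, x ∈ l := by
    by_contra! hno
    have hlong : ∀ m : ℕ, ∃ l : List W, l.IsChain H.Adj ∧ l.Nodup ∧ l.length = m := by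
      intro m
      induction m with
      | zero => exact ⟨[], by simp⟩
      | succ m ih =>
        obtain ⟨l, hl, hnd, rfl⟩ := ih
        exact exists_isChain_nodup_length_succ ht.connected hdeg hl hnd (hno l hl hnd)
    obtain ⟨l, -, hnd, hlen⟩ := hlong (Fintype.card W + 1)
    have := hnd.length_le_card
    omega
  obtain ⟨l, hl, hnd, hall⟩ := hspan
  let e : Fin l.length ≃ W := hnd.getEquivOfForallMemList l hall
  have he : ∀ i, e i = l[i] := fun i => rfl
  let P : SimpleGraph W := (SimpleGraph.pathGraph l.length).map e.toEmbedding
  have iso : SimpleGraph.pathGraph l.length ≃g P := SimpleGraph.Iso.map e _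
  have hne : l.length ≠ 0 := by
    obtain ⟨x⟩ := ht.connected.nonempty
    exact List.length_pos_of_mem (hall x) |>.ne'
  have hP : P.Connected := by
    refine iso.connected_iff.mp ?_
    obtain ⟨n, hn⟩ := Nat.exists_eq_succ_of_ne_zero hne
    rw [hn]
    exact SimpleGraph.pathGraph_connected n
  have hle : P ≤ H := by
    rintro _ _ h
    rw [SimpleGraph.map_adj] at h
    obtain ⟨i, j, hij, rfl, rfl⟩ := h
    rw [List.isChain_iff_getElem] at hl
    change H.Adj (l[i]) (l[j])
    rw [SimpleGraph.pathGraph_adj] at hij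
    rcases hij with h | h
    · have := hl i (by omega)
      simpa [h] using this
    · have := (hl j (by omega)).symm
      simpa [h] using this
  have hPH : P = H :=
    le_antisymm hle ((SimpleGraph.isTree_iff_minimal_connected.mp ht).2 hP hle)
  exact ⟨l.length, ⟨(hPH ▸ iso).symm⟩⟩

/-- A set of pairwise disjoint edges covers twice as many vertices as it has edges. -/
lemma two_mul_ncard_le_of_pairwise_disjoint {V : Type*} [Finite V] {N : Set (Sym2 V)}
    {S : Set V} (hdiag : ∀ e ∈ N, ¬ e.IsDiag)
    (hdisj : ∀ e ∈ N, ∀ f ∈ N, e ≠ f → ∀ v, v ∈ e → v ∉ f)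
    (hS : ∀ e ∈ N, ∀ v ∈ e, v ∈ S) : 2 * N.ncard ≤ S.ncard := by
  classical
  have := Fintype.ofFinite V
  have hcard : (N.toFinset.biUnion Sym2.toFinset).card = ∑ e ∈ N.toFinset, 2 := by
    rw [Finset.card_biUnion]
    · exact Finset.sum_congr rfl fun e he =>
        Sym2.card_toFinset_of_not_isDiag e (hdiag e (by simpa using he))
    · intro e he f hf hef
      rw [Function.onFun, Finset.disjoint_left]
      intro v hv hv'
      exact hdisj e (by simpa using he) f (by simpa using hf) hef v
        (by simpa using hv) (by simpa using hv')
  rw [Set.ncard_eq_toFinset_card' N, Set.ncard_eq_toFinset_card' S]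
  calc 2 * N.toFinset.card = (N.toFinset.biUnion Sym2.toFinset).card := by
        rw [hcard, Finset.sum_const, smul_eq_mul, mul_comm]
    _ ≤ S.toFinset.card := Finset.card_le_card fun v hv => by
        simp only [Finset.mem_biUnion, Set.mem_toFinset, Sym2.mem_toFinset] at hv ⊢
        obtain ⟨e, he, hv⟩ := hv
        exact hS e he v hv

section SymmDiffGraph

variable {V : Type*} {G : SimpleGraph V} {M M' : Set (Sym2 V)}

lemma IsMatchingSet.eq_of_mem (hM : IsMatchingSet G M) {e f : Sym2 V} (he : e ∈ M) (hf : f ∈ M)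
    {v : V} (hve : v ∈ e) (hvf : v ∈ f) : e = f := by
  by_contra h
  exact hM.2 e he f hf h v hve hvf

lemma not_isDiag_of_mem_symmDiff (hM : M ⊆ G.edgeSet) (hM' : M' ⊆ G.edgeSet) {e : Sym2 V}
    (he : e ∈ symmDiff M M') : ¬ e.IsDiag :=
  G.not_isDiag_of_mem_edgeSet (he.elim (fun h => hM h.1) (fun h => hM' h.1))

/-- An edge of the symmetric difference with one end in a component lies in that component. -/
lemma mem_compEdges_of_mem_supp {c : (symmDiffGraph M M').ConnectedComponent} {e : Sym2 V}
    (he : e ∈ symmDiff M M') {v : V} (hv : v ∈ e) (hvc : v ∈ c.supp) : e ∈ compEdges M M' c := by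
  refine ⟨he, fun w hw => ?_⟩
  by_cases hvw : v = w
  · exact hvw ▸ hvc
  · refine c.mem_supp_of_adj_mem_supp hvc ?_
    rw [symmDiffGraph, SimpleGraph.fromEdgeSet_adj]
    rw [(Sym2.mem_and_mem_iff hvw).mp ⟨hv, hw⟩] at he
    exact ⟨he, hvw⟩

lemma compEdges_inj_of_mem {c d : (symmDiffGraph M M').ConnectedComponent} {e : Sym2 V}
    (hc : e ∈ compEdges M M' c) (hd : e ∈ compEdges M M' d) : c = d :=
  SimpleGraph.ConnectedComponent.eq_of_common_vertex (hc.2 _ e.out_fst_mem) (hd.2 _ e.out_fst_mem)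

/-- The components partition any set of edges of the symmetric difference. -/
lemma sum_ncard_compEdges_inter [Finite V] [Fintype (symmDiffGraph M M').ConnectedComponent]
    {S : Set (Sym2 V)} (hS : S ⊆ symmDiff M M') :
    ∑ c, (compEdges M M' c ∩ S).ncard = S.ncard := by
  classical
  have := Fintype.ofFinite V
  have hSU : S.toFinset = Finset.univ.biUnion fun c => (compEdges M M' c ∩ S).toFinset := by
    ext e
    simp only [Set.mem_toFinset, Finset.mem_biUnion, Finset.mem_univ, true_and, Set.mem_inter_iff,
      exists_and_right]
    exact ⟨fun he => ⟨⟨_, mem_compEdges_of_mem_supp (hS he) e.out_fst_mem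
      SimpleGraph.ConnectedComponent.connectedComponentMk_mem⟩, he⟩, fun h => h.2⟩
  rw [Set.ncard_eq_toFinset_card' S, hSU, Finset.card_biUnion]
  · exact Finset.sum_congr rfl fun c _ => Set.ncard_eq_toFinset_card' _
  · intro c _ d _ hcd
    rw [Function.onFun, Finset.disjoint_left]
    intro e he he'
    simp only [Set.mem_toFinset] at he he'
    exact hcd (compEdges_inj_of_mem he.1 he'.1)

/-- Every vertex of the symmetric difference of two matchings has degree at most two. -/
lemma symmDiffGraph_adj_eq_or (hM : IsMatchingSet G M) (hM' : IsMatchingSet G M') {x a b c : V}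
    (ha : (symmDiffGraph M M').Adj x a) (hb : (symmDiffGraph M M').Adj x b)
    (hc : (symmDiffGraph M M').Adj x c) : a = b ∨ a = c ∨ b = c := by
  have key : ∀ N, IsMatchingSet G N → ∀ u v, s(x, u) ∈ N → s(x, v) ∈ N → u = v :=
    fun N hN u v hu hv => Sym2.congr_right.mp
      (hN.eq_of_mem hu hv (Sym2.mem_mk_left x u) (Sym2.mem_mk_left x v))
  have hor : ∀ u, (symmDiffGraph M M').Adj x u → s(x, u) ∈ M ∨ s(x, u) ∈ M' := fun u hu =>
    ((SimpleGraph.fromEdgeSet_adj _).mp hu).1.imp And.left And.left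
  have h₁ := key M hM
  have h₂ := key M' hM'
  rcases hor a ha with ha | ha <;> rcases hor b hb with hb | hb <;>
    rcases hor c hc with hc | hc <;> grind

lemma image_edgeSet_induce_supp (hM : M ⊆ G.edgeSet) (hM' : M' ⊆ G.edgeSet)
    (c : (symmDiffGraph M M').ConnectedComponent) :
    Sym2.map Subtype.val '' ((symmDiffGraph M M').induce c.supp).edgeSet = compEdges M M' c := by
  ext e
  constructor
  · rintro ⟨f, hf, rfl⟩
    induction f with | _ a b
    rw [SimpleGraph.mem_edgeSet, SimpleGraph.comap_adj] at hf
    exact mem_compEdges_of_mem_supp ((SimpleGraph.fromEdgeSet_adj _).mp hf).1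
      (Sym2.mem_mk_left _ _) a.2
  · intro he
    have hdiag := not_isDiag_of_mem_symmDiff hM hM' he.1
    induction e with | _ a b
    refine ⟨s(⟨a, he.2 a (Sym2.mem_mk_left a b)⟩, ⟨b, he.2 b (Sym2.mem_mk_right a b)⟩), ?_, rfl⟩
    rw [SimpleGraph.mem_edgeSet, SimpleGraph.comap_adj]
    exact (SimpleGraph.fromEdgeSet_adj _).mpr ⟨he.1, by simpa using hdiag⟩

lemma ncard_compEdges_eq_card_edgeSet (hM : M ⊆ G.edgeSet) (hM' : M' ⊆ G.edgeSet)
    (c : (symmDiffGraph M M').ConnectedComponent) :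
    (compEdges M M' c).ncard = Nat.card ((symmDiffGraph M M').induce c.supp).edgeSet := by
  rw [← image_edgeSet_induce_supp hM hM',
    Set.ncard_image_of_injective _ (Sym2.map.injective Subtype.val_injective), Nat.card_coe_set_eq]

lemma ncard_compEdges [Finite V] (c : (symmDiffGraph M M').ConnectedComponent) :
    (compEdges M M' c).ncard =
      (compEdges M M' c ∩ M).ncard + (compEdges M M' c ∩ M').ncard := by
  rw [← Set.ncard_union_eq _ (Set.toFinite _) (Set.toFinite _)]
  · congr 1
    ext e
    have : e ∈ compEdges M M' c → e ∈ M ∨ e ∈ M' := fun he => he.1.imp And.left And.left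
    simp only [Set.mem_union, Set.mem_inter_iff]
    tauto
  · rw [Set.disjoint_left]
    rintro e ⟨⟨he | he, -⟩, h⟩ ⟨-, h'⟩
    · exact he.2 h'
    · exact he.2 h

lemma two_mul_ncard_compEdges_inter_le [Finite V] (hM' : IsMatchingSet G M')
    (c : (symmDiffGraph M M').ConnectedComponent) :
    2 * (compEdges M M' c ∩ M').ncard ≤ Nat.card c.supp := by
  rw [Nat.card_coe_set_eq]
  exact two_mul_ncard_le_of_pairwise_disjoint
    (fun e he => G.not_isDiag_of_mem_edgeSet (hM'.1 he.2))
    (fun e he f hf => hM'.2 e he.2 f hf.2) (fun e he => he.1.2)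

lemma card_supp_le_ncard_compEdges_add_one (hM : M ⊆ G.edgeSet) (hM' : M' ⊆ G.edgeSet)
    (c : (symmDiffGraph M M').ConnectedComponent) :
    Nat.card c.supp ≤ (compEdges M M' c).ncard + 1 := by
  rw [ncard_compEdges_eq_card_edgeSet hM hM']
  exact c.connected_toSimpleGraph.card_vert_le_card_edgeSet_add_one

lemma ncard_compEdges_inter_le_add_one [Finite V] (hM : IsMatchingSet G M)
    (hM' : IsMatchingSet G M') (c : (symmDiffGraph M M').ConnectedComponent) :
    (compEdges M M' c ∩ M').ncard ≤ (compEdges M M' c ∩ M).ncard + 1 := by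
  have h₁ := two_mul_ncard_compEdges_inter_le hM' c
  have h₂ := card_supp_le_ncard_compEdges_add_one hM.1 hM'.1 c
  rw [ncard_compEdges] at h₂
  omega

/-- A component is a pink chain as soon as it has one more edge of `M'` than of `M`. -/
lemma isPinkChain_iff_ncard_eq [Finite V] (hM : IsMatchingSet G M) (hM' : IsMatchingSet G M')
    (c : (symmDiffGraph M M').ConnectedComponent) :
    IsPinkChain M M' c ↔
      (compEdges M M' c ∩ M').ncard = (compEdges M M' c ∩ M).ncard + 1 := by
  refine ⟨And.right, fun h => ⟨?_, h⟩⟩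
  have h₁ := two_mul_ncard_compEdges_inter_le hM' c
  have h₂ := card_supp_le_ncard_compEdges_add_one hM.1 hM'.1 c
  have h₃ := ncard_compEdges c
  have ht : ((symmDiffGraph M M').induce c.supp).IsTree := by
    refine SimpleGraph.isTree_iff_connected_and_card.mpr ⟨c.connected_toSimpleGraph, ?_⟩
    rw [← ncard_compEdges_eq_card_edgeSet hM.1 hM'.1]
    omega
  refine ht.exists_iso_pathGraph fun x a b d ha hb hd => ?_
  simp only [Subtype.ext_iff]
  exact symmDiffGraph_adj_eq_or hM hM' ha hb hd

/-- The number of pink chains is at least the difference of the sizes of the matchings. -/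
lemma ncard_le_ncard_add_pinkCount [Finite V] (hM : IsMatchingSet G M)
    (hM' : IsMatchingSet G M') : M'.ncard ≤ M.ncard + pinkCount M M' := by
  classical
  have := Fintype.ofFinite (symmDiffGraph M M').ConnectedComponent
  have hsum' := sum_ncard_compEdges_inter (M := M) (M' := M') (S := M' \ M) fun _ => Or.inr
  have hsum := sum_ncard_compEdges_inter (M := M) (M' := M') (S := M \ M') fun _ => Or.inl
  have hinter' : ∀ c, compEdges M M' c ∩ (M' \ M) = compEdges M M' c ∩ M' := fun c => by
    ext e
    exact ⟨fun h => ⟨h.1, h.2.1⟩,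
      fun h => ⟨h.1, h.1.1.elim (fun h' => (h'.2 h.2).elim) id⟩⟩
  have hinter : ∀ c, compEdges M M' c ∩ (M \ M') = compEdges M M' c ∩ M := fun c => by
    ext e
    exact ⟨fun h => ⟨h.1, h.2.1⟩,
      fun h => ⟨h.1, h.1.1.elim id (fun h' => (h'.2 h.2).elim)⟩⟩
  simp only [hinter', hinter] at hsum' hsum
  have hle : ∑ c, (compEdges M M' c ∩ M').ncard ≤
      ∑ c, ((compEdges M M' c ∩ M).ncard + if IsPinkChain M M' c then 1 else 0) := by
    refine Finset.sum_le_sum fun c _ => ?_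
    have h := ncard_compEdges_inter_le_add_one hM hM' c
    have hp := isPinkChain_iff_ncard_eq hM hM' c
    split_ifs with hc
    · exact h
    · rw [hp] at hc
      omega
  rw [Finset.sum_add_distrib, hsum', hsum, ← Finset.card_filter, ← Fintype.card_subtype,
    ← Nat.card_eq_fintype_card] at hle
  have h₁ := Set.ncard_inter_add_ncard_sdiff_eq_ncard M M' (Set.toFinite _)
  have h₂ := Set.ncard_inter_add_ncard_sdiff_eq_ncard M' M (Set.toFinite _)
  rw [Set.inter_comm] at h₂
  rw [pinkCount]
  omega

lemma ncard_swapSet : (swapSet M M').ncard = pinkCount M M' := by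
  rw [pinkCount, ← Nat.card_coe_set_eq]
  symm
  refine Nat.card_congr (Equiv.ofBijective (fun c => ⟨_, c.1, c.2, rfl⟩) ⟨?_, ?_⟩)
  · rintro ⟨c, hc⟩ ⟨d, hd⟩ h
    have h₁ : (M \ compEdges M M' c) ∪ (M' ∩ compEdges M M' c) =
        (M \ compEdges M M' d) ∪ (M' ∩ compEdges M M' d) := congrArg (fun p => p.1.1) h
    have hne : (compEdges M M' c ∩ M').Nonempty := by
      refine Set.nonempty_of_ncard_ne_zero ?_
      rw [hc.2]
      omega
    obtain ⟨e, hec, heM'⟩ := hne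
    have heM : e ∉ M := hec.1.elim (fun h => (h.2 heM').elim) And.right
    have he : e ∈ (M \ compEdges M M' d) ∪ (M' ∩ compEdges M M' d) :=
      h₁.subset (Or.inr ⟨heM', hec⟩)
    exact Subtype.ext (compEdges_inj_of_mem hec (he.elim (fun h => (heM h.1).elim) And.right))
  · rintro ⟨p, c, hc, rfl⟩
    exact ⟨⟨c, hc⟩, rfl⟩

/-- Swapping two matchings along a closed set of edges `C` gives a matching. -/
lemma IsMatchingSet.swap (hM : IsMatchingSet G M) (hM' : IsMatchingSet G M')
    (C : Set (Sym2 V)) (hC : ∀ e ∈ symmDiff M M', ∀ f ∈ C, ∀ v ∈ e, v ∈ f → e ∈ C) :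
    IsMatchingSet G ((M \ C) ∪ (M' ∩ C)) := by
  have hcross : ∀ e ∈ M \ C, ∀ f ∈ M' ∩ C, ∀ v, v ∈ e → v ∉ f := by
    intro e he f hf v hve hvf
    by_cases heM' : e ∈ M'
    · exact he.2 (hM'.eq_of_mem heM' hf.1 hve hvf ▸ hf.2)
    · exact he.2 (hC e (Or.inl ⟨he.1, heM'⟩) f hf.2 v hve hvf)
  refine ⟨Set.union_subset (fun e he => hM.1 he.1) (fun e he => hM'.1 he.1), ?_⟩
  rintro e (he | he) f (hf | hf) hef v hve hvf
  · exact hM.2 e he.1 f hf.1 hef v hve hvf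
  · exact hcross e he f hf v hve hvf
  · exact hcross f hf e he v hvf hve
  · exact hM'.2 e he.1 f hf.1 hef v hve hvf

lemma ncard_diff_union_inter_add [Finite V] (M M' C : Set (Sym2 V)) :
    ((M \ C) ∪ (M' ∩ C)).ncard + (C ∩ M).ncard = M.ncard + (C ∩ M').ncard := by
  rw [Set.ncard_union_eq (Set.disjoint_left.mpr fun e he he' => he.2 he'.2) (Set.toFinite _)
    (Set.toFinite _)]
  have := Set.ncard_inter_add_ncard_sdiff_eq_ncard M C (Set.toFinite _)
  rw [Set.inter_comm C M, Set.inter_comm C M']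
  omega

end SymmDiffGraph

/-- For a matching `M` of size `ℓ-1` and a matching `M'` of size `k+1` on a finite simple
graph `G` with `1 ≤ ℓ ≤ k`, the graph `D(M,M')` has at least `k − ℓ + 2 ≥ 2` pink chains;
consequently `N(M,M')` has cardinality `p ≥ 2`, and every pair in `N(M,M')` consists of a
matching of size `ℓ` and a matching of size `k`. -/
theorem swapSet_card_and_membership
    (V : Type) [Fintype V] [DecidableEq V] (G : SimpleGraph V)
    (ℓ k : ℕ) (hℓ : 1 ≤ ℓ) (hℓk : ℓ ≤ k)
    (M M' : Set (Sym2 V))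
    (hM : IsMatchingSet G M) (hMcard : M.ncard = ℓ - 1)
    (hM' : IsMatchingSet G M') (hM'card : M'.ncard = k + 1) :
    k - ℓ + 2 ≤ pinkCount M M' ∧
    (swapSet M M').ncard = pinkCount M M' ∧
    2 ≤ (swapSet M M').ncard ∧
    ∀ N N' : Set (Sym2 V), (N, N') ∈ swapSet M M' →
      IsMatchingSet G N ∧ N.ncard = ℓ ∧ IsMatchingSet G N' ∧ N'.ncard = k := by
  have hpink := ncard_le_ncard_add_pinkCount hM hM'
  rw [hMcard, hM'card] at hpink
  rw [ncard_swapSet]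
  refine ⟨by omega, rfl, by omega, ?_⟩
  rintro N N' ⟨c, hc, h⟩
  obtain ⟨rfl, rfl⟩ := Prod.mk.inj h
  have hclosed : ∀ e ∈ symmDiff M M', ∀ f ∈ compEdges M M' c, ∀ v ∈ e, v ∈ f →
      e ∈ compEdges M M' c := fun e he f hf v hve hvf =>
    mem_compEdges_of_mem_supp he hve (hf.2 v hvf)
  have hcard := ncard_diff_union_inter_add M M' (compEdges M M' c)
  have hcard' := ncard_diff_union_inter_add M' M (compEdges M M' c)
  have := hc.2
  exact ⟨hM.swap hM' _ hclosed, by omega,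
    hM'.swap hM _ (by rwa [symmDiff_comm]), by omega⟩
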